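/- For all k ∈ ℤ and m,n ∈ ℕ, in C one has: r^{k,m,n}·t_33 = q^{−(m+n)} r^{k,m,n}·t_22 − θ(k) q(1 − q^{−2k}) r^{k−1,m,n}·(t_12 t_21); r^{k,m,n}·t_34 = −q^{−k} r^{k,m,n}·t_21; r^{k,m,n}·t_43 = −q^{−k} r^{k,m,n}·t_12; and r^{k,m,n}·t_44 = q^{m+n} r^{k,m,n}·t_11 − θ(−k) q^{m+n−1}(1 − q^{−2k}) r^{k+1,m,n}·(t_12 t_21), where θ(k) = 1 for k ≥ 0 and θ(k) = 0 for k < 0. -/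

import Mathlib

open scoped TensorProduct

noncomputable section

namespace QIB

/-- Generators of `A(U_q(4))`: the matrix entries `t i j` and the extra generator `D_q⁻¹`. -/
abbrev genU : Type := (Fin 4 × Fin 4) ⊕ Unit

abbrev FU : Type := FreeAlgebra ℂ genU

def T (i j : Fin 4) : FU := FreeAlgebra.ι ℂ (Sum.inl (i, j))

def Dinv0 : FU := FreeAlgebra.ι ℂ (Sum.inr ())

/-- The length (number of inversions) of a permutation of `Fin 4`. -/
def plen (σ : Equiv.Perm (Fin 4)) : ℕ :=
  ((Finset.univ : Finset (Fin 4 × Fin 4)).filter fun p => p.1 < p.2 ∧ σ p.2 < σ p.1).card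

/-- The quantum determinant, as an element of the free algebra. -/
def Dq0 (q : ℝ) : FU :=
  ∑ σ : Equiv.Perm (Fin 4),
    ((-(q : ℂ)) ^ plen σ) • (T (σ 0) 0 * T (σ 1) 1 * T (σ 2) 2 * T (σ 3) 3)

/-- The defining relations of `A(U_q(4))`. -/
inductive relU (q : ℝ) : FU → FU → Prop
  | col {i j k : Fin 4} : i < j → relU q (T i k * T j k) ((q : ℂ) • (T j k * T i k))
  | row {i j k : Fin 4} : i < j → relU q (T k i * T k j) ((q : ℂ) • (T k j * T k i))
  | comm {i j k l : Fin 4} : i < j → k < l → relU q (T i l * T j k) (T j k * T i l)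
  | qcom {i j k l : Fin 4} : i < j → k < l →
      relU q (T i k * T j l - T j l * T i k) (((q : ℂ) - (q : ℂ)⁻¹) • (T j k * T i l))
  | dr : relU q (Dq0 q * Dinv0) 1
  | dl : relU q (Dinv0 * Dq0 q) 1

variable (q : ℝ)

/-- The algebra `A(U_q(4))`. -/
abbrev AU : Type := RingQuot (relU q)

/-- The generators `t i j` of `A(U_q(4))` (indices are 0-based). -/
def tt (i j : Fin 4) : AU q := RingQuot.mkAlgHom ℂ (relU q) (T i j)

/-- The generator `D_q⁻¹`. -/
def dI : AU q := RingQuot.mkAlgHom ℂ (relU q) Dinv0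

/-- The quantum determinant `D_q` in `A(U_q(4))`. -/
def Dq : AU q := RingQuot.mkAlgHom ℂ (relU q) (Dq0 q)

/-- The spanning set `R` of relation elements (0-based indices). -/
def Rset : Set (AU q) :=
  {tt q 0 2, tt q 2 0, tt q 0 3, tt q 3 0, tt q 1 3, tt q 3 1, tt q 1 2, tt q 2 1,
   tt q 0 0 - tt q 3 3, tt q 0 1 + tt q 3 2, tt q 1 0 + tt q 2 3, tt q 1 1 - tt q 2 2,
   tt q 0 0 * tt q 1 1 - (q : ℂ) • (tt q 0 1 * tt q 1 0) - 1}

/-- The right ideal `ℛ = R · A(U_q(4))`, as a `ℂ`-submodule. -/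
def RIdeal : Submodule ℂ (AU q) :=
  Submodule.span ℂ {y | ∃ x ∈ Rset q, ∃ a : AU q, y = x * a}

/-- The coalgebra `C = A(U_q(4)) / ℛ`. -/
abbrev Cq : Type := AU q ⧸ RIdeal q

/-- The canonical projection `r : A(U_q(4)) → C`. -/
def rr : AU q →ₗ[ℂ] Cq q := (RIdeal q).mkQ

lemma RIdeal_mul_right {y : AU q} (hy : y ∈ RIdeal q) (c : AU q) : y * c ∈ RIdeal q := by
  induction hy using Submodule.span_induction with
  | mem x hx =>
      obtain ⟨x0, hx0, a, rfl⟩ := hx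
      exact Submodule.subset_span ⟨x0, hx0, a * c, by rw [mul_assoc]⟩
  | zero => simp
  | add u v _ _ hu hv => simpa [add_mul] using (RIdeal q).add_mem hu hv
  | smul a u _ hu => simpa [smul_mul_assoc] using (RIdeal q).smul_mem a hu

/-- Auxiliary map for the right `A(U_q(4))`-module structure of `C`:
right multiplication by `c` descends to the quotient. -/
def cactAux (c : AU q) : Cq q →ₗ[ℂ] Cq q :=
  Submodule.liftQ (RIdeal q) ((RIdeal q).mkQ ∘ₗ LinearMap.mulRight ℂ c)
    (by
      intro y hy
      simp only [LinearMap.mem_ker, LinearMap.comp_apply, LinearMap.mulRight_apply,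
        Submodule.mkQ_apply, Submodule.Quotient.mk_eq_zero]
      exact RIdeal_mul_right q hy c)

@[simp] lemma cactAux_mk (c a : AU q) :
    cactAux q c (Submodule.Quotient.mk a) = (Submodule.Quotient.mk (a * c) : Cq q) := by
  simp [cactAux]

/-- The right `A(U_q(4))`-module structure `r(t) · t' := r(t t')` of `C`,
as a bilinear map `A(U_q(4)) →ₗ C →ₗ C`, `(c, x) ↦ x · c`. -/
def cact : AU q →ₗ[ℂ] Cq q →ₗ[ℂ] Cq q where
  toFun c := cactAux q c
  map_add' c c' := by
    refine LinearMap.ext fun x => ?_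
    obtain ⟨a, rfl⟩ := Submodule.Quotient.mk_surjective _ x
    simp only [cactAux_mk, mul_add, Submodule.Quotient.mk_add, LinearMap.add_apply]
  map_smul' s c := by
    refine LinearMap.ext fun x => ?_
    obtain ⟨a, rfl⟩ := Submodule.Quotient.mk_surjective _ x
    simp only [cactAux_mk, mul_smul_comm, Submodule.Quotient.mk_smul, RingHom.id_apply, LinearMap.smul_apply]

@[simp] lemma cact_mk (c a : AU q) : cact q c (rr q a) = rr q (a * c) := by
  simp [cact, rr]

/-- θ(k) = 1 for k ≥ 0 and 0 for k < 0. -/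
def thetaZ (k : ℤ) : ℂ := if 0 ≤ k then 1 else 0

/-- The linear basis elements `r^{k,m,n}` of `C`, given as representatives in `A(U_q(4))`. -/
def bas (k : ℤ) (m n : ℕ) : AU q :=
  if 0 ≤ k then tt q 0 0 ^ k.toNat * tt q 0 1 ^ m * tt q 1 0 ^ n
  else tt q 0 1 ^ m * tt q 1 0 ^ n * tt q 1 1 ^ (-k).toNat

/-! ### The quantum seven-sphere -/

/-- Generators of `A(S⁷_q)`: `(i, false)` is `z_i`, `(i, true)` is `z_i^*`. -/
abbrev genS : Type := Fin 4 × Bool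

abbrev FS : Type := FreeAlgebra ℂ genS

def Z0 (i : Fin 4) : FS := FreeAlgebra.ι ℂ (i, false)

def Zs0 (i : Fin 4) : FS := FreeAlgebra.ι ℂ (i, true)

/-- The defining relations of the ∗-algebra `A(S⁷_q)` (including the ∗-conjugate of the
first family of relations, so that the relation set is closed under the involution). -/
inductive relS (q : ℝ) : FS → FS → Prop
  | zz {i j : Fin 4} : i < j → relS q (Z0 i * Z0 j) ((q : ℂ) • (Z0 j * Z0 i))
  | ss {i j : Fin 4} : i < j → relS q (Zs0 j * Zs0 i) ((q : ℂ) • (Zs0 i * Zs0 j))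
  | sz {i j : Fin 4} : i ≠ j → relS q (Zs0 j * Z0 i) ((q : ℂ) • (Z0 i * Zs0 j))
  | szz {k : Fin 4} : relS q (Zs0 k * Z0 k)
      (Z0 k * Zs0 k + (1 - (q : ℂ) ^ 2) •
        ∑ j ∈ Finset.univ.filter (· < k), Z0 j * Zs0 j)
  | sum1 : relS q (∑ k : Fin 4, Z0 k * Zs0 k) 1

/-- The algebra `P = A(S⁷_q)`. -/
abbrev PA : Type := RingQuot (relS q)

/-- The generators `z_i` of `A(S⁷_q)` (0-based index). -/
def z (i : Fin 4) : PA q := RingQuot.mkAlgHom ℂ (relS q) (Z0 i)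

/-- The generators `z_i^*` of `A(S⁷_q)` (0-based index). -/
def zs (i : Fin 4) : PA q := RingQuot.mkAlgHom ℂ (relS q) (Zs0 i)

/-- The element `R = z₁ z₁^* + z₂ z₂^*` of `A(S⁷_q)`. -/
def RRe [StarRing (PA q)] : PA q := z q 0 * star (z q 0) + z q 1 * star (z q 1)

/-- The element `a = z₁ z₄^* − z₂ z₃^*` of `A(S⁷_q)`. -/
def aa [StarRing (PA q)] : PA q := z q 0 * star (z q 3) - z q 1 * star (z q 2)

/-- The element `b = z₁ z₃ + q⁻¹ z₂ z₄` of `A(S⁷_q)`. -/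
def bb : PA q := z q 0 * z q 2 + (q : ℂ)⁻¹ • (z q 1 * z q 3)

/-- The elements `a_n = z₁ z₄^* − qⁿ z₂ z₃^*` of `A(S⁷_q)`. -/
def aN [StarRing (PA q)] (n : ℤ) : PA q :=
  z q 0 * star (z q 3) - ((q : ℂ) ^ n) • (z q 1 * star (z q 2))

/-- The elements `b_n = z₁ z₃ + q^{n−1} z₂ z₄` of `A(S⁷_q)`. -/
def bN (n : ℤ) : PA q := z q 0 * z q 2 + ((q : ℂ) ^ (n - 1)) • (z q 1 * z q 3)

/-! ### The coaction, the coinvariants and the canonical map -/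

variable (δ : PA q →ₐ[ℂ] PA q ⊗[ℂ] AU q)

/-- `Δ_r := (id ⊗ r) ∘ Δ : A(S⁷_q) → A(S⁷_q) ⊗ C`, built from the
`A(U_q(4))`-coaction `δ`. -/
def Dr : PA q →ₗ[ℂ] PA q ⊗[ℂ] Cq q :=
  (LinearMap.lTensor (PA q) (rr q)) ∘ₗ δ.toLinearMap

/-- The set of coinvariants `B = A(Σ⁴_q) = {a | Δ_r(a) = a ⊗ r(1)}`. -/
def Bset : Set (PA q) := {a : PA q | Dr q δ a = a ⊗ₜ[ℂ] rr q 1}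

/-- The subspace of `P ⊗ P` spanned by the elements `(u b) ⊗ v − u ⊗ (b v)` with `b`
a coinvariant; quotienting by it produces the balanced tensor product `P ⊗_B P`. -/
def relT : Submodule ℂ (PA q ⊗[ℂ] PA q) :=
  Submodule.span ℂ
    {x : PA q ⊗[ℂ] PA q | ∃ u v b : PA q, b ∈ Bset q δ ∧
      x = (u * b) ⊗ₜ[ℂ] v - u ⊗ₜ[ℂ] (b * v)}

set_option maxSynthPendingDepth 4

/-- The balanced tensor product `P ⊗_B P` over the coinvariant subalgebra `B = A(Σ⁴_q)`. -/
abbrev PBP : Type := (PA q ⊗[ℂ] PA q) ⧸ relT q δ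

/-- The canonical projection `P ⊗ P → P ⊗_B P`. -/
def mkT : PA q ⊗[ℂ] PA q →ₗ[ℂ] PBP q δ := (relT q δ).mkQ

lemma relT_map_lmul (p : PA q) {x : PA q ⊗[ℂ] PA q} (hx : x ∈ relT q δ) :
    TensorProduct.map (LinearMap.mulLeft ℂ p) LinearMap.id x ∈ relT q δ := by
  induction hx using Submodule.span_induction with
  | mem y hy =>
      obtain ⟨u, v, b, hb, rfl⟩ := hy
      refine Submodule.subset_span ⟨p * u, v, b, hb, ?_⟩
      simp [TensorProduct.map_tmul, mul_assoc]
  | zero => simp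
  | add u v _ _ hu hv => simpa [map_add] using Submodule.add_mem _ hu hv
  | smul a u _ hu => simpa [map_smul] using Submodule.smul_mem _ a hu

lemma relT_map_rmul (p : PA q) {x : PA q ⊗[ℂ] PA q} (hx : x ∈ relT q δ) :
    TensorProduct.map LinearMap.id (LinearMap.mulRight ℂ p) x ∈ relT q δ := by
  induction hx using Submodule.span_induction with
  | mem y hy =>
      obtain ⟨u, v, b, hb, rfl⟩ := hy
      refine Submodule.subset_span ⟨u, v * p, b, hb, ?_⟩
      simp [TensorProduct.map_tmul, mul_assoc]
  | zero => simp
  | add u v _ _ hu hv => simpa [map_add] using Submodule.add_mem _ hu hv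
  | smul a u _ hu => simpa [map_smul] using Submodule.smul_mem _ a hu

/-- Left multiplication by `p ∈ P` on the bimodule `P ⊗_B P`. -/
def lact (p : PA q) : PBP q δ →ₗ[ℂ] PBP q δ :=
  Submodule.liftQ (relT q δ)
    ((relT q δ).mkQ ∘ₗ TensorProduct.map (LinearMap.mulLeft ℂ p) LinearMap.id)
    (by
      intro x hx
      simp only [LinearMap.mem_ker, LinearMap.comp_apply, Submodule.mkQ_apply,
        Submodule.Quotient.mk_eq_zero]
      exact relT_map_lmul q δ p hx)

/-- Right multiplication by `p ∈ P` on the bimodule `P ⊗_B P`. -/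
def ract (p : PA q) : PBP q δ →ₗ[ℂ] PBP q δ :=
  Submodule.liftQ (relT q δ)
    ((relT q δ).mkQ ∘ₗ TensorProduct.map LinearMap.id (LinearMap.mulRight ℂ p))
    (by
      intro x hx
      simp only [LinearMap.mem_ker, LinearMap.comp_apply, Submodule.mkQ_apply,
        Submodule.Quotient.mk_eq_zero]
      exact relT_map_rmul q δ p hx)

/-- The structure map of the right action `◁` of `A(S⁷_q)` on `A(S⁷_q) ⊗ C`:
on simple tensors, `(u ⊗ x) ⊗ (w ⊗ y) ↦ (u w) ⊗ (x · y)`.  The action is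
`(u ⊗ x) ◁ v = triMap ((u ⊗ x) ⊗ δ v) = Σ u v₍₀₎ ⊗ x · v₍₁₎`. -/
def triMap : (PA q ⊗[ℂ] Cq q) ⊗[ℂ] (PA q ⊗[ℂ] AU q) →ₗ[ℂ] PA q ⊗[ℂ] Cq q :=
  (TensorProduct.map (LinearMap.mul' ℂ (PA q)) (TensorProduct.lift (LinearMap.flip (cact q)))) ∘ₗ
    (TensorProduct.tensorTensorTensorComm ℂ (PA q) (Cq q) (PA q) (AU q)).toLinearMap

section alg

variable {A : Type*} [Ring A] [Algebra ℂ A]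

lemma pow_comm_left {x y : A} {s : ℂ} (h : x * y = s • (y * x)) (n : ℕ) :
    x ^ n * y = s ^ n • (y * x ^ n) := by
  induction n with
  | zero => simp
  | succ n ih =>
    rw [pow_succ, mul_assoc, h, mul_smul_comm, ← mul_assoc, ih, smul_mul_assoc, smul_smul,
      mul_assoc, pow_succ s, mul_comm]

lemma pow_comm_right {x y : A} {s : ℂ} (h : x * y = s • (y * x)) (n : ℕ) :
    x * y ^ n = s ^ n • (y ^ n * x) := by
  induction n with
  | zero => simp
  | succ n ih =>
    rw [pow_succ, ← mul_assoc, ih, smul_mul_assoc, mul_assoc, h, mul_smul_comm, smul_smul,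
      ← mul_assoc, pow_succ s]

lemma inv_comm {x y : A} {s : ℂ} (hs : s ≠ 0) (h : x * y = s • (y * x)) :
    y * x = s⁻¹ • (x * y) := by
  rw [h, smul_smul, inv_mul_cancel₀ hs, one_smul]

/-- `x` past `y^(p+1)` when the commutator is `u • e` with `e` quasi-commuting with `y`. -/
lemma comm_pow_succ {x y e : A} {u s v : ℂ} (h : x * y = y * x + u • e)
    (he : e * y = s • (y * e)) (hv : v * (1 - s) = u) (p : ℕ) :
    x * y ^ (p + 1) = y ^ (p + 1) * x + (v * (1 - s ^ (p + 1))) • (y ^ p * e) := by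
  induction p with
  | zero => simp [h, hv]
  | succ p ih =>
    have e1 : y ^ (p + 1) * (x * y) = y ^ (p + 1 + 1) * x + u • (y ^ (p + 1) * e) := by
      rw [h, mul_add, mul_smul_comm, pow_succ y (p + 1), mul_assoc]
    have e2 : y ^ p * (e * y) = s • (y ^ (p + 1) * e) := by
      rw [he, mul_smul_comm, pow_succ, mul_assoc]
    rw [pow_succ y (p + 1), ← mul_assoc, ih, add_mul, mul_assoc, e1, smul_mul_assoc,
      mul_assoc, e2, smul_smul, add_assoc, ← add_smul, pow_succ y (p + 1)]
    congr 2
    rw [← hv]; ring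

end alg

section rels

lemma tt_col {i j k : Fin 4} (h : i < j) :
    tt q i k * tt q j k = (q : ℂ) • (tt q j k * tt q i k) := by
  have := RingQuot.mkAlgHom_rel ℂ (relU.col (q := q) (k := k) h)
  simpa only [map_mul, map_smul, tt] using this

lemma tt_row {i j k : Fin 4} (h : i < j) :
    tt q k i * tt q k j = (q : ℂ) • (tt q k j * tt q k i) := by
  have := RingQuot.mkAlgHom_rel ℂ (relU.row (q := q) (k := k) h)
  simpa only [map_mul, map_smul, tt] using this

lemma tt_comm {i j k l : Fin 4} (h : i < j) (h' : k < l) :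
    tt q i l * tt q j k = tt q j k * tt q i l := by
  have := RingQuot.mkAlgHom_rel ℂ (relU.comm (q := q) h h')
  simpa only [map_mul, tt] using this

lemma tt_qcom {i j k l : Fin 4} (h : i < j) (h' : k < l) :
    tt q i k * tt q j l = tt q j l * tt q i k
      + ((q : ℂ) - (q : ℂ)⁻¹) • (tt q j k * tt q i l) := by
  have := RingQuot.mkAlgHom_rel ℂ (relU.qcom (q := q) h h')
  simp only [map_mul, map_smul, map_sub] at this
  rw [add_comm, ← sub_eq_iff_eq_add]
  exact this

/-- Positions outside the two diagonal blocks. -/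
def offP (i j : Fin 4) : Prop := (i < 2 ∧ 2 ≤ j) ∨ (2 ≤ i ∧ j < 2)

/-- The right ideal generated by the off-diagonal blocks. -/
def offJ : Submodule ℂ (AU q) :=
  Submodule.span ℂ {y | ∃ i j, offP i j ∧ ∃ a : AU q, y = tt q i j * a}

lemma offJ_gen {i j : Fin 4} (h : offP i j) (a : AU q) : tt q i j * a ∈ offJ q :=
  Submodule.subset_span ⟨i, j, h, a, rfl⟩

lemma offJ_mul {y : AU q} (hy : y ∈ offJ q) (c : AU q) : y * c ∈ offJ q := by
  induction hy using Submodule.span_induction with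
  | mem x hx =>
      obtain ⟨i, j, h, a, rfl⟩ := hx
      rw [mul_assoc]; exact offJ_gen q h _
  | zero => simp
  | add u v _ _ hu hv => simpa [add_mul] using (offJ q).add_mem hu hv
  | smul a u _ hu => simpa [smul_mul_assoc] using (offJ q).smul_mem a hu

lemma offJ_le : offJ q ≤ RIdeal q := by
  refine Submodule.span_le.2 ?_
  rintro y ⟨i, j, h, a, rfl⟩
  refine Submodule.subset_span ⟨_, ?_, a, rfl⟩
  unfold offP at h
  simp only [Rset, Set.mem_insert_iff]
  fin_cases i <;> fin_cases j <;> first | (exfalso; revert h; decide) | simp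

/-- Elements preserving `offJ` from the left and commuting with the lower block modulo it. -/
def good (w : AU q) : Prop :=
  (∀ y ∈ offJ q, w * y ∈ offJ q) ∧
    ∀ i j : Fin 4, 2 ≤ i → 2 ≤ j → w * tt q i j - tt q i j * w ∈ offJ q

lemma good_one : good q 1 := by
  refine ⟨fun y hy => by simpa using hy, fun i j _ _ => by simp⟩

lemma good_mul {w v : AU q} (hw : good q w) (hv : good q v) : good q (w * v) := by
  refine ⟨fun y hy => by rw [mul_assoc]; exact hw.1 _ (hv.1 _ hy), fun i j hi hj => ?_⟩
  have : w * v * tt q i j - tt q i j * (w * v)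
      = w * (v * tt q i j - tt q i j * v) + (w * tt q i j - tt q i j * w) * v := by
    noncomm_ring
  rw [this]
  exact (offJ q).add_mem (hw.1 _ (hv.2 i j hi hj)) (offJ_mul q (hw.2 i j hi hj) v)

lemma good_pow {w : AU q} (hw : good q w) (n : ℕ) : good q (w ^ n) := by
  induction n with
  | zero => simpa using good_one q
  | succ n ih => rw [pow_succ]; exact good_mul q ih hw

lemma good_tt (hq : q ≠ 0) {k l : Fin 4} (hk : k < 2) (hl : l < 2) : good q (tt q k l) := by
  have hqc : (q : ℂ) ≠ 0 := by exact_mod_cast hq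
  have hgen : ∀ i j, offP i j → tt q k l * tt q i j ∈ offJ q := by
    intro i j h
    rcases h with ⟨hi, hj⟩ | ⟨hi, hj⟩
    · have hlj : l < j := lt_of_lt_of_le hl hj
      rcases lt_trichotomy k i with h | h | h
      · rw [tt_qcom q h hlj, ← tt_comm q h hlj]
        exact (offJ q).add_mem (offJ_gen q (Or.inl ⟨hi, hj⟩) _)
          ((offJ q).smul_mem _ (offJ_gen q (Or.inl ⟨hk, hj⟩) _))
      · subst h
        rw [tt_row q hlj]
        exact (offJ q).smul_mem _ (offJ_gen q (Or.inl ⟨hi, hj⟩) _)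
      · rw [← tt_comm q h hlj]
        exact offJ_gen q (Or.inl ⟨hi, hj⟩) _
    · have hki : k < i := lt_of_lt_of_le hk hi
      rcases lt_trichotomy l j with h | h | h
      · rw [tt_qcom q hki h]
        exact (offJ q).add_mem (offJ_gen q (Or.inr ⟨hi, hj⟩) _)
          ((offJ q).smul_mem _ (offJ_gen q (Or.inr ⟨hi, hl⟩) _))
      · subst h
        rw [tt_col q hki]
        exact (offJ q).smul_mem _ (offJ_gen q (Or.inr ⟨hi, hj⟩) _)
      · rw [tt_comm q hki h]
        exact offJ_gen q (Or.inr ⟨hi, hj⟩) _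
  refine ⟨fun y hy => ?_, fun i j hi hj => ?_⟩
  · induction hy using Submodule.span_induction with
    | mem x hx =>
        obtain ⟨i, j, h, a, rfl⟩ := hx
        rw [← mul_assoc]
        exact offJ_mul q (hgen i j h) a
    | zero => simp
    | add u v _ _ hu hv => simpa [mul_add] using (offJ q).add_mem hu hv
    | smul a u _ hu => simpa [mul_smul_comm] using (offJ q).smul_mem a hu
  · rw [tt_qcom q (lt_of_lt_of_le hk hi) (lt_of_lt_of_le hl hj), add_sub_cancel_left]
    exact (offJ q).smul_mem _ (offJ_gen q (Or.inr ⟨hi, hl⟩) _)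

lemma good_bas (hq : q ≠ 0) (k : ℤ) (m n : ℕ) : good q (bas q k m n) := by
  have h2 : (0 : Fin 4) < 2 := by decide
  have h3 : (1 : Fin 4) < 2 := by decide
  have ha := good_tt q hq h2 h2
  have hb := good_tt q hq h2 h3
  have hc := good_tt q hq h3 h2
  have hd := good_tt q hq h3 h3
  unfold bas
  split_ifs
  · exact good_mul q (good_mul q (good_pow q ha _) (good_pow q hb _)) (good_pow q hc _)
  · exact good_mul q (good_mul q (good_pow q hb _) (good_pow q hc _)) (good_pow q hd _)

lemma rr_eq_of_sub_mem {x y : AU q} (h : x - y ∈ RIdeal q) : rr q x = rr q y := by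
  rw [← sub_eq_zero, ← map_sub]
  exact (Submodule.Quotient.mk_eq_zero _).2 h

lemma rr_good {w : AU q} (hw : good q w) {i j : Fin 4} (hi : 2 ≤ i) (hj : 2 ≤ j) :
    rr q (w * tt q i j) = rr q (tt q i j * w) :=
  rr_eq_of_sub_mem q (offJ_le q (hw.2 i j hi hj))

lemma Rset_mul {x : AU q} (hx : x ∈ Rset q) (a : AU q) : x * a ∈ RIdeal q :=
  Submodule.subset_span ⟨x, hx, a, rfl⟩

lemma rr_22 (a : AU q) : rr q (tt q 2 2 * a) = rr q (tt q 1 1 * a) := by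
  refine (rr_eq_of_sub_mem q ?_).symm
  rw [← sub_mul]
  exact Rset_mul q (by simp [Rset]) a

lemma rr_33 (a : AU q) : rr q (tt q 3 3 * a) = rr q (tt q 0 0 * a) := by
  refine (rr_eq_of_sub_mem q ?_).symm
  rw [← sub_mul]
  exact Rset_mul q (by simp [Rset]) a

lemma rr_23 (a : AU q) : rr q (tt q 2 3 * a) = - rr q (tt q 1 0 * a) := by
  rw [← map_neg]
  refine rr_eq_of_sub_mem q ?_
  rw [sub_neg_eq_add, add_comm, ← add_mul]
  exact Rset_mul q (by simp [Rset]) a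

lemma rr_32 (a : AU q) : rr q (tt q 3 2 * a) = - rr q (tt q 0 1 * a) := by
  rw [← map_neg]
  refine rr_eq_of_sub_mem q ?_
  rw [sub_neg_eq_add, add_comm, ← add_mul]
  exact Rset_mul q (by simp [Rset]) a

lemma bas_nat (p m n : ℕ) :
    bas q (p : ℤ) m n = tt q 0 0 ^ p * tt q 0 1 ^ m * tt q 1 0 ^ n := by
  simp [bas]

lemma bas_neg (p m n : ℕ) :
    bas q (-(p : ℤ)) m n = tt q 0 1 ^ m * tt q 1 0 ^ n * tt q 1 1 ^ p := by
  rcases Nat.eq_zero_or_pos p with rfl | hp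
  · simp [bas]
  · have : ¬ (0 : ℤ) ≤ -(p : ℤ) := by omega
    rw [bas, if_neg this]; simp

end rels

section abs

variable {A : Type*} [Ring A] [Algebra ℂ A] {a b c d : A} {Q : ℂ}

lemma bc_mono {x : A} {s : ℂ} (hb : x * b = s • (b * x)) (hc : x * c = s • (c * x)) (m n : ℕ) :
    x * (b ^ m * c ^ n) = s ^ (m + n) • (b ^ m * c ^ n * x) := by
  rw [← mul_assoc, pow_comm_right hb, smul_mul_assoc, mul_assoc, pow_comm_right hc,
    mul_smul_comm, smul_smul, ← pow_add, mul_assoc]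

lemma bc_prod {x : A} {s : ℂ} (hb : b * x = s • (x * b)) (hc : c * x = s • (x * c)) :
    b * c * x = (s ^ 2) • (x * (b * c)) := by
  rw [mul_assoc, hc, mul_smul_comm, ← mul_assoc, hb, smul_mul_assoc, smul_smul, mul_assoc, sq]

end abs

theorem module_relations_block22 (q : ℝ) (hq0 : 0 < q) (hq1 : q < 1)
    (k : ℤ) (m n : ℕ)
        : rr q (bas q k m n * tt q 2 2)
      = ((q : ℂ) ^ (-((m : ℤ) + (n : ℤ)))) • rr q (bas q k m n * tt q 1 1)
        - (thetaZ k * (q : ℂ) * (1 - (q : ℂ) ^ (-(2 * k)))) •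
            rr q (bas q (k - 1) m n * (tt q 0 1 * tt q 1 0)) ∧
    rr q (bas q k m n * tt q 2 3) = -(((q : ℂ) ^ (-k)) • rr q (bas q k m n * tt q 1 0)) ∧
    rr q (bas q k m n * tt q 3 2) = -(((q : ℂ) ^ (-k)) • rr q (bas q k m n * tt q 0 1)) ∧
    rr q (bas q k m n * tt q 3 3)
      = ((q : ℂ) ^ ((m : ℤ) + (n : ℤ))) • rr q (bas q k m n * tt q 0 0)
        - (thetaZ (-k) * (q : ℂ) ^ ((m : ℤ) + (n : ℤ) - 1) * (1 - (q : ℂ) ^ (-(2 * k)))) •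
            rr q (bas q (k + 1) m n * (tt q 0 1 * tt q 1 0)) := by
  have hq : q ≠ 0 := hq0.ne'
  have hQ : (q : ℂ) ≠ 0 := by exact_mod_cast hq
  have hg := good_bas q hq k m n
  have l22 : (2 : Fin 4) ≤ 2 := by decide
  have l23 : (2 : Fin 4) ≤ 3 := by decide
  have l01 : (0 : Fin 4) < 1 := by decide
  rw [rr_good q hg l22 l22, rr_good q hg l22 l23, rr_good q hg l23 l22, rr_good q hg l23 l23,
    rr_22, rr_23, rr_32, rr_33]
  simp only [← map_smul, ← map_sub, neg_inj]
  have hab : tt q 0 0 * tt q 0 1 = (q : ℂ) • (tt q 0 1 * tt q 0 0) := tt_row q l01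
  have hac : tt q 0 0 * tt q 1 0 = (q : ℂ) • (tt q 1 0 * tt q 0 0) := tt_col q l01
  have hbd : tt q 0 1 * tt q 1 1 = (q : ℂ) • (tt q 1 1 * tt q 0 1) := tt_col q l01
  have hcd : tt q 1 0 * tt q 1 1 = (q : ℂ) • (tt q 1 1 * tt q 1 0) := tt_row q l01
  have hbc : tt q 0 1 * tt q 1 0 = tt q 1 0 * tt q 0 1 := tt_comm q l01 l01
  have had : tt q 0 0 * tt q 1 1 = tt q 1 1 * tt q 0 0
      + ((q : ℂ) - (q : ℂ)⁻¹) • (tt q 0 1 * tt q 1 0) := by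
    rw [hbc]; exact tt_qcom q l01 l01
  clear hg
  have hk : (∃ p : ℕ, k = p) ∨ ∃ p : ℕ, k = -((p + 1 : ℕ) : ℤ) := by
    rcases le_or_gt 0 k with h | h
    · exact Or.inl ⟨k.toNat, by omega⟩
    · exact Or.inr ⟨(-k).toNat - 1, by omega⟩
  have hpm : (q : ℂ) ^ ((m : ℤ) + (n : ℤ)) = (q : ℂ) ^ (m + n) := by
    rw [← Nat.cast_add, zpow_natCast]
  have hpmi : (q : ℂ) ^ (-((m : ℤ) + (n : ℤ))) = ((q : ℂ)⁻¹) ^ (m + n) := by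
    rw [zpow_neg, hpm, inv_pow]
  have hpm1 : (q : ℂ) ^ ((m : ℤ) + (n : ℤ) - 1) = (q : ℂ) ^ (m + n) * (q : ℂ)⁻¹ := by
    rw [zpow_sub₀ hQ, hpm, zpow_one, div_eq_mul_inv]
  rw [hpmi, hpm, hpm1]
  generalize hA : tt q 0 0 = a at *
  generalize hB : tt q 0 1 = b at *
  generalize hC : tt q 1 0 = c at *
  generalize hD : tt q 1 1 = d at *
  have hba := inv_comm hQ hab
  have hca := inv_comm hQ hac
  have hdb := inv_comm hQ hbd
  have hdc := inv_comm hQ hcd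
  have hda : d * a = a * d + (-((q : ℂ) - (q : ℂ)⁻¹)) • (b * c) := by
    rw [had, neg_smul]; abel
  have hbcC : Commute b c := hbc
  have hcw : c * (b ^ m * c ^ n) = b ^ m * c ^ n * c := by
    rw [← mul_assoc, ← (hbcC.pow_left m).eq, mul_assoc, mul_assoc, ← pow_succ, ← pow_succ']
  have hbw : b * (b ^ m * c ^ n) = b ^ m * c ^ n * b := by
    rw [mul_assoc, ← (hbcC.pow_right n).eq, ← mul_assoc, ← mul_assoc, ← pow_succ, ← pow_succ']
  have haw := bc_mono hab hac m n
  have hdw := bc_mono hdb hdc m n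
  have hea := bc_prod hba hca
  have hed := bc_prod hbd hcd
  have hew : b * c * (b ^ m * c ^ n) = b ^ m * c ^ n * (b * c) := by
    rw [mul_assoc, hcw, ← mul_assoc, hbw, mul_assoc]
  rcases hk with ⟨p, rfl⟩ | ⟨p, rfl⟩
  · -- nonnegative exponent
    have hpk : (q : ℂ) ^ (-(p : ℤ)) = ((q : ℂ)⁻¹) ^ p := by
      rw [zpow_neg, zpow_natCast, inv_pow]
    have hp2 : (q : ℂ) ^ (-(2 * (p : ℤ))) = (((q : ℂ)⁻¹) ^ 2) ^ p := by
      rw [← pow_mul, inv_pow, ← zpow_natCast, zpow_neg]; push_cast; rfl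
    have hth : thetaZ (p : ℤ) = 1 := by simp [thetaZ]
    rw [hpk, hp2, hth, bas_nat, hA, hB, hC]
    simp only [mul_assoc (a ^ _) (b ^ m) (c ^ n)]
    refine ⟨?_, ?_, ?_, ?_⟩
    · congr 1
      rcases p with _ | p
      · simp [hdw]
      · have e := comm_pow_succ (v := -(q : ℂ)) hda hea (by field_simp) p
        have : ((p + 1 : ℕ) : ℤ) - 1 = p := by push_cast; ring
        rw [this, bas_nat, hA, hB, hC, ← mul_assoc, e, add_mul, mul_assoc, hdw]
        simp only [mul_assoc (a ^ _), smul_mul_assoc, mul_smul_comm]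
        rw [hew]
        simp only [mul_assoc]
        module
    · congr 1
      rw [← mul_assoc, pow_comm_right hca, smul_mul_assoc, mul_assoc, hcw, mul_assoc (a ^ p)]
    · congr 1
      rw [← mul_assoc, pow_comm_right hba, smul_mul_assoc, mul_assoc, hbw, mul_assoc (a ^ p)]
    · congr 1
      have hz : thetaZ (-(p : ℤ)) * ((q : ℂ) ^ (m + n) * (q : ℂ)⁻¹) *
          (1 - ((q : ℂ)⁻¹ ^ 2) ^ p) = 0 := by
        rcases p with _ | p
        · simp
        · have : ¬ (0 : ℤ) ≤ -((p + 1 : ℕ) : ℤ) := by omega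
          simp only [thetaZ, if_neg this, zero_mul]
      rw [hz, zero_smul, sub_zero, ← mul_assoc, ← pow_succ', pow_succ, mul_assoc, haw,
        mul_smul_comm, mul_assoc (a ^ p)]
  · -- negative exponent
    have hpk : (q : ℂ) ^ (-(-((p + 1 : ℕ) : ℤ))) = (q : ℂ) ^ (p + 1) := by
      rw [neg_neg, zpow_natCast]
    have hp2 : (q : ℂ) ^ (-(2 * (-((p + 1 : ℕ) : ℤ)))) = ((q : ℂ) ^ 2) ^ (p + 1) := by
      rw [← pow_mul, ← zpow_natCast]; congr 1
    have hth : thetaZ (-((p + 1 : ℕ) : ℤ)) = 0 := by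
      have : ¬ (0 : ℤ) ≤ -((p + 1 : ℕ) : ℤ) := by omega
      simp only [thetaZ, if_neg this]
    have hth2 : thetaZ (-(-((p + 1 : ℕ) : ℤ))) = 1 := by
      have : (0 : ℤ) ≤ -(-((p + 1 : ℕ) : ℤ)) := by omega
      simp only [thetaZ, if_pos this]
    have hk1 : -((p + 1 : ℕ) : ℤ) + 1 = -(p : ℤ) := by push_cast; ring
    rw [hpk, hp2, hth, hth2, hk1, bas_neg, bas_neg, hB, hC, hD]
    refine ⟨?_, ?_, ?_, ?_⟩
    · congr 1
      rw [zero_mul, zero_mul, zero_smul, sub_zero, ← mul_assoc, hdw, smul_mul_assoc, mul_assoc,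
        mul_assoc (b ^ m * c ^ n), ← pow_succ, ← pow_succ']
    · congr 1
      rw [← mul_assoc, hcw, mul_assoc, pow_comm_right hcd, mul_smul_comm,
        mul_assoc (b ^ m * c ^ n)]
    · congr 1
      rw [← mul_assoc, hbw, mul_assoc, pow_comm_right hbd, mul_smul_comm,
        mul_assoc (b ^ m * c ^ n)]
    · congr 1
      have e := comm_pow_succ (v := -(q : ℂ)⁻¹) had hed (by field_simp; ring) p
      rw [← mul_assoc, haw, smul_mul_assoc, mul_assoc, e, mul_add, smul_add, mul_smul_comm,
        smul_smul]
      simp only [mul_assoc]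
      module

end QIB
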